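/- Assume c > 0. There exists h₀ > 0, depending only on p, β⁻, β⁺, γ and c, such that whenever the mesh size h = max hᵢ satisfies h ≤ h₀, every v in the immersed trial space U_T satisfies the coercivity bound a(v, Π_h v) ≥ ½ min{min(β⁻,β⁺), c} ‖v‖₁², where ‖v‖²₁ = ∫_a^b (v′(x)² + v(x)²) dx. -/

import Mathlib

open Set

/-- The piecewise-constant diffusion coefficient with interface point `α`. -/
noncomputable def betaPW (βm βp α : ℝ) : ℝ → ℝ := fun t => if t < α then βm else βp

/-- Membership in the immersed trial space `U_T`: continuous on `[a,b]`, zero boundary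
values, a polynomial of degree ≤ p on each non-interface element `[x_{i-1}, x_i]` (i ≠ k),
and on the interface element `[x_{k-1}, x_k]` a continuous piecewise polynomial of degree ≤ p
satisfying the derivative jump conditions at the interface `α`. -/
def MemUT (p N k : ℕ) (a b α βm βp : ℝ) (x : ℕ → ℝ) (v : ℝ → ℝ) : Prop :=
  ContinuousOn v (Set.Icc a b) ∧ v a = 0 ∧ v b = 0 ∧
  (∀ i, 1 ≤ i → i ≤ N → i ≠ k → ∃ q : Polynomial ℝ, q.natDegree ≤ p ∧
    ∀ y ∈ Set.Icc (x (i - 1)) (x i), v y = q.eval y) ∧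
  ∃ qm qp : Polynomial ℝ, qm.natDegree ≤ p ∧ qp.natDegree ≤ p ∧
    (∀ y ∈ Set.Icc (x (k - 1)) α, v y = qm.eval y) ∧
    (∀ y ∈ Set.Icc α (x k), v y = qp.eval y) ∧
    ∀ j, 1 ≤ j → j ≤ p →
      βm * ((⇑Polynomial.derivative)^[j] qm).eval α
        = βp * ((⇑Polynomial.derivative)^[j] qp).eval α

/-- The previous value `v_{i,j-1}` of a test coefficient vector, with the conventions
`v_{1,0} = 0` and `v_{i,0} = v_{i-1,p}`. -/
noncomputable def vprev (p : ℕ) (w : ℕ → ℕ → ℝ) (i j : ℕ) : ℝ :=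
  if j = 1 then (if i = 1 then 0 else w (i - 1) p) else w i (j - 1)

/-- The jump `[v_{i,j}] = v_{i,j} − v_{i,j−1}` of a test coefficient vector. -/
noncomputable def jmp (p : ℕ) (w : ℕ → ℕ → ℝ) (i j : ℕ) : ℝ := w i j - vprev p w i j

/-- The squared norm `‖v‖²_{T'} = |v|²_{1,T'} + ‖v‖²_{0,T'}` on test coefficient vectors. -/
noncomputable def normTpSq (N p : ℕ) (x : ℕ → ℝ) (w : ℕ → ℕ → ℝ) : ℝ :=
  (∑ i ∈ Finset.Icc 1 N, ∑ j ∈ Finset.Icc 1 p, (x i - x (i - 1))⁻¹ * (jmp p w i j) ^ 2)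
    + ∑ i ∈ Finset.Icc 1 N, ∑ j ∈ Finset.Icc 1 (if i < N then p else p - 1),
        (x i - x (i - 1)) * (w i j) ^ 2

/-- The norm `‖v‖_{T'}` on test coefficient vectors. -/
noncomputable def normTp (N p : ℕ) (x : ℕ → ℝ) (w : ℕ → ℕ → ℝ) : ℝ :=
  Real.sqrt (normTpSq N p x w)

/-- The IFVM bilinear form
`a(u,v) = Σᵢ Σ_{j=1}^{p} [v_{i,j}] β(g_{i,j}) u′(g_{i,j})
        + Σᵢ Σ_{j=1}^{pᵢ} v_{i,j} ∫_{g_{i,j}}^{g_{i,j+1}} (γ u′ + c u)`. -/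
noncomputable def aform (N p : ℕ) (γ c βm βp α : ℝ) (g : ℕ → ℕ → ℝ)
    (u : ℝ → ℝ) (w : ℕ → ℕ → ℝ) : ℝ :=
  (∑ i ∈ Finset.Icc 1 N, ∑ j ∈ Finset.Icc 1 p,
      jmp p w i j * (betaPW βm βp α (g i j) * deriv u (g i j)))
    + ∑ i ∈ Finset.Icc 1 N, ∑ j ∈ Finset.Icc 1 (if i < N then p else p - 1),
        w i j * ∫ t in (g i j)..(g i (j + 1)), (γ * deriv u t + c * u t)

/-- The mapping `Π_h` from trial functions to test coefficient vectors: the entry `(i,j)`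
is the partial (lexicographic) sum of `A_{m,n} β(g_{m,n}) v′(g_{m,n})`, so that
`[v_{i,j}] = A_{i,j} β(g_{i,j}) v′(g_{i,j})`, together with the convention `v_{N,p} = 0`. -/
noncomputable def pih (N p : ℕ) (βm βp α : ℝ) (g A : ℕ → ℕ → ℝ) (v : ℝ → ℝ) :
    ℕ → ℕ → ℝ :=
  fun i j => if i = N ∧ j = p then 0 else
    (∑ m ∈ Finset.Icc 1 (i - 1), ∑ n ∈ Finset.Icc 1 p,
        A m n * (betaPW βm βp α (g m n) * deriv v (g m n)))
      + ∑ n ∈ Finset.Icc 1 j, A i n * (betaPW βm βp α (g i n) * deriv v (g i n))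

open MeasureTheory

theorem sq_integral_abs_le {lo hi : ℝ} (h : lo ≤ hi) {u : ℝ → ℝ}
    (hu : MemLp u 2 (volume.restrict (Ioc lo hi))) :
    (∫ t in lo..hi, |u t|) ^ 2 ≤ (hi - lo) * ∫ t in lo..hi, u t ^ 2 := by
  have h1 : IntervalIntegrable (fun t => |u t|) volume lo hi :=
    ((intervalIntegrable_iff_integrableOn_Ioc_of_le h).2 (hu.integrable one_le_two)).abs
  have h2 : IntervalIntegrable (fun t => u t ^ 2) volume lo hi :=
    (intervalIntegrable_iff_integrableOn_Ioc_of_le h).2 hu.integrable_sq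
  rcases h.eq_or_lt with rfl | hlt
  · simp
  set J := ∫ t in lo..hi, |u t| with hJ
  have key : 0 ≤ ∫ t in lo..hi, ((hi - lo) * |u t| - J) ^ 2 :=
    intervalIntegral.integral_nonneg h fun t _ => sq_nonneg _
  have e : ∀ t, ((hi - lo) * |u t| - J) ^ 2
      = (hi - lo) ^ 2 * u t ^ 2 - (2 * (hi - lo) * J) * |u t| + J ^ 2 := fun t => by
    rw [← sq_abs (u t)]; ring
  simp_rw [e] at key
  rw [intervalIntegral.integral_add ((h2.const_mul _).sub (h1.const_mul _)) (by simp),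
    intervalIntegral.integral_sub (h2.const_mul _) (h1.const_mul _),
    intervalIntegral.integral_const_mul, intervalIntegral.integral_const_mul,
    intervalIntegral.integral_const, ← hJ, smul_eq_mul] at key
  have h3 : 0 < hi - lo := sub_pos.2 hlt
  by_contra! hc
  nlinarith

theorem abs_sum_mul_integral_sub_le {n : ℕ} {y S : ℕ → ℝ} {v f : ℝ → ℝ} {K : ℝ}
    (hy : ∀ j < n, y j ≤ y (j + 1))
    (hf : ∀ j < n, IntervalIntegrable f volume (y j) (y (j + 1)))
    (hvf : ∀ j < n, IntervalIntegrable (fun t => v t * f t) volume (y j) (y (j + 1)))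
    (hK : ∀ j < n, ∀ t ∈ Icc (y j) (y (j + 1)), |S j - v t| ≤ K) :
    |(∑ j ∈ Finset.range n, S j * ∫ t in (y j)..(y (j + 1)), f t)
      - ∫ t in (y 0)..(y n), v t * f t| ≤ K * ∫ t in (y 0)..(y n), |f t| := by
  rw [← intervalIntegral.sum_integral_adjacent_intervals hvf,
    ← intervalIntegral.sum_integral_adjacent_intervals (fun j hj => (hf j hj).abs),
    ← Finset.sum_sub_distrib, Finset.mul_sum]
  refine (Finset.abs_sum_le_sum_abs _ _).trans (Finset.sum_le_sum fun j hj => ?_)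
  rw [Finset.mem_range] at hj
  rw [← intervalIntegral.integral_const_mul, ← intervalIntegral.integral_const_mul,
    ← intervalIntegral.integral_sub ((hf j hj).const_mul _) (hvf j hj)]
  refine (intervalIntegral.abs_integral_le_integral_abs (hy j hj)).trans
    (intervalIntegral.integral_mono_on (hy j hj)
      (((hf j hj).const_mul _).sub (hvf j hj)).abs ((hf j hj).abs.const_mul _) fun t ht => ?_)
  rw [← sub_mul, abs_mul]
  exact mul_le_mul_of_nonneg_right (hK j hj t ht) (abs_nonneg _)

theorem sum_Icc_integral_eq {N : ℕ} {x : ℕ → ℝ} {f : ℝ → ℝ}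
    (hf : ∀ i ∈ Finset.Icc 1 N, IntervalIntegrable f volume (x (i - 1)) (x i)) :
    ∑ i ∈ Finset.Icc 1 N, ∫ t in (x (i - 1))..(x i), f t = ∫ t in (x 0)..(x N), f t := by
  rw [← intervalIntegral.sum_integral_adjacent_intervals (n := N)
    (fun i hi => by simpa using hf (i + 1) (by simp; omega)),
    Finset.range_eq_Ico]
  exact (Finset.sum_Ico_add' (fun i => ∫ t in (x (i - 1))..(x i), f t) 0 N 1).symm

theorem C_mul_derivative_eq {p : ℕ} {s r α : ℝ} {q₁ q₂ : Polynomial ℝ}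
    (h₁ : q₁.natDegree ≤ p) (h₂ : q₂.natDegree ≤ p)
    (h : ∀ j, 1 ≤ j → j ≤ p → s * ((⇑Polynomial.derivative)^[j] q₁).eval α
        = r * ((⇑Polynomial.derivative)^[j] q₂).eval α) :
    Polynomial.C s * q₁.derivative = Polynomial.C r * q₂.derivative := by
  rw [← sub_eq_zero]
  by_contra h0
  have hroot : p - 1 < (Polynomial.C s * q₁.derivative
      - Polynomial.C r * q₂.derivative).rootMultiplicity α := by
    rw [Polynomial.lt_rootMultiplicity_iff_isRoot_iterate_derivative h0]
    intro j hj
    rcases Nat.eq_zero_or_pos p with rfl | hp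
    · rw [Polynomial.natDegree_eq_zero.1 (by omega : q₁.natDegree = 0) |>.choose_spec.symm,
        Polynomial.natDegree_eq_zero.1 (by omega : q₂.natDegree = 0) |>.choose_spec.symm]
      simp
    · have := h (j + 1) (by omega) (by omega)
      simp only [Function.iterate_succ, Function.comp_apply] at this
      simp [Polynomial.IsRoot,
        Polynomial.iterate_derivative_C_mul, this]
  have hdeg : (Polynomial.C s * q₁.derivative - Polynomial.C r * q₂.derivative).natDegree
      ≤ p - 1 := by
    have hd (r : ℝ) {q : Polynomial ℝ} (hq : q.natDegree ≤ p) :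
        (Polynomial.C r * q.derivative).natDegree ≤ p - 1 :=
      (Polynomial.natDegree_C_mul_le _ _).trans
        (q.natDegree_derivative_le.trans (Nat.sub_le_sub_right hq 1))
    exact (Polynomial.natDegree_sub_le_of_le (hd s h₁) (hd r h₂)).trans (max_self _).le
  rw [← Polynomial.count_roots] at hroot
  exact (hroot.trans_le ((Multiset.count_le_card _ _).trans
    ((Polynomial.card_roots' _).trans hdeg))).false

theorem element_young {h R I1 I0 T X Y g c : ℝ} (hg : 0 ≤ g) (hc : 0 ≤ c)
    (hT : T ^ 2 ≤ R * (h * I1)) (hX : X ^ 2 ≤ h * I1) (hY : Y ^ 2 ≤ h * I0)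
    (hR : 0 ≤ R) :
    (T + X) * (g * X + c * Y) ≤ h * ((g + c) * (R + 3) / 2) * (I1 + I0) := by
  have a1 : T * X ≤ (R + 1) / 2 * (h * I1) := by nlinarith [sq_nonneg (T - X)]
  have a2 : T * Y ≤ (R * (h * I1) + h * I0) / 2 := by nlinarith [sq_nonneg (T - Y)]
  have a3 : X * Y ≤ (h * I1 + h * I0) / 2 := by nlinarith [sq_nonneg (X - Y)]
  have b1 : T * X + X ^ 2 ≤ (R + 3) / 2 * (h * I1 + h * I0) := by nlinarith
  have b2 : T * Y + X * Y ≤ (R + 3) / 2 * (h * I1 + h * I0) := by nlinarith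
  have := mul_le_mul_of_nonneg_left b1 hg
  have := mul_le_mul_of_nonneg_left b2 hc
  nlinarith

theorem abs_element_sum_sub_le {lo hi γ c T R : ℝ} {v d : ℝ → ℝ} (h : lo ≤ hi)
    (hv : MemLp v 2 (volume.restrict (Ioc lo hi)))
    (hd : MemLp d 2 (volume.restrict (Ioc lo hi)))
    (hFTC : ∀ s ∈ Icc lo hi, ∫ t in lo..s, d t = v s - v lo) (hc : 0 ≤ c)
    {n : ℕ} {y S : ℕ → ℝ} (hy : ∀ j < n, y j ≤ y (j + 1)) (hy0 : y 0 = lo) (hyn : y n = hi)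
    (hT0 : 0 ≤ T) (hS : ∀ j < n, |S j - v lo| ≤ T) (hR : 0 ≤ R)
    (hT : T ^ 2 ≤ R * ((hi - lo) * ∫ t in lo..hi, d t ^ 2)) :
    |(∑ j ∈ Finset.range n, S j * ∫ t in (y j)..(y (j + 1)), (γ * d t + c * v t))
      - ∫ t in lo..hi, v t * (γ * d t + c * v t)|
      ≤ (hi - lo) * ((|γ| + c) * (R + 3) / 2) * ∫ t in lo..hi, (d t ^ 2 + v t ^ 2) := by
  have toII {u : ℝ → ℝ} (hu : Integrable u (volume.restrict (Ioc lo hi))) :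
      IntervalIntegrable u volume lo hi :=
    (intervalIntegrable_iff_integrableOn_Ioc_of_le h).2 hu
  have hd1 := toII (hd.integrable one_le_two)
  have hv1 := toII (hv.integrable one_le_two)
  have hd2 := toII hd.integrable_sq
  have hv2 := toII hv.integrable_sq
  have hvd : IntervalIntegrable (fun t => v t * d t) volume lo hi :=
    toII (hv.integrable_mul hd)
  have hf : IntervalIntegrable (fun t => γ * d t + c * v t) volume lo hi :=
    (hd1.const_mul γ).add (hv1.const_mul c)
  have hvf : IntervalIntegrable (fun t => v t * (γ * d t + c * v t)) volume lo hi := by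
    refine ((hvd.const_mul γ).add (hv2.const_mul c)).congr fun t _ => ?_
    ring
  have hmono : ∀ i j, i ≤ j → j ≤ n → y i ≤ y j := fun i j hij => by
    induction j, hij using Nat.le_induction with
    | base => exact fun _ => le_rfl
    | succ j _ ih => exact fun hj => (ih (by omega)).trans (hy j (by omega))
  have hlo : ∀ j ≤ n, lo ≤ y j := fun j hj => hy0 ▸ hmono 0 j (Nat.zero_le _) hj
  have hhi : ∀ j ≤ n, y j ≤ hi := fun j hj => hyn ▸ hmono j n hj le_rfl
  have hsub : ∀ j < n, uIcc (y j) (y (j + 1)) ⊆ uIcc lo hi := fun j hj => by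
    rw [uIcc_of_le (hy j hj), uIcc_of_le h]
    exact Icc_subset_Icc (hlo j hj.le) (hhi _ hj)
  set X := ∫ t in lo..hi, |d t| with hX
  set Y := ∫ t in lo..hi, |v t| with hY
  have hX0 : 0 ≤ X := intervalIntegral.integral_nonneg h fun _ _ => abs_nonneg _
  have hvar : ∀ s ∈ Icc lo hi, |v s - v lo| ≤ X := fun s hs => by
    rw [← hFTC s hs]
    refine (intervalIntegral.abs_integral_le_integral_abs hs.1).trans ?_
    exact intervalIntegral.integral_mono_interval le_rfl hs.1 hs.2
      (Filter.Eventually.of_forall fun _ => abs_nonneg _) hd1.abs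
  have key := abs_sum_mul_integral_sub_le (n := n) (y := y) (S := S) (v := v)
    (f := fun t => γ * d t + c * v t) (K := T + X) hy
    (fun j hj => hf.mono_set (hsub j hj)) (fun j hj => hvf.mono_set (hsub j hj))
    (fun j hj t ht => by
      have h1 := hS j hj
      have h2 := hvar t ⟨(hlo j hj.le).trans ht.1, ht.2.trans (hhi _ hj)⟩
      calc |S j - v t| = |(S j - v lo) - (v t - v lo)| := by ring_nf
        _ ≤ |S j - v lo| + |v t - v lo| := abs_sub _ _
        _ ≤ T + X := add_le_add h1 h2)
  rw [hy0, hyn] at key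
  refine key.trans ?_
  have hF : ∫ t in lo..hi, |γ * d t + c * v t| ≤ |γ| * X + c * Y := by
    rw [hX, hY, ← intervalIntegral.integral_const_mul, ← intervalIntegral.integral_const_mul,
      ← intervalIntegral.integral_add (hd1.abs.const_mul _) (hv1.abs.const_mul _)]
    refine intervalIntegral.integral_mono_on h hf.abs
      ((hd1.abs.const_mul _).add (hv1.abs.const_mul _)) fun t _ => ?_
    refine (abs_add_le _ _).trans ?_
    rw [abs_mul, abs_mul, abs_of_nonneg hc]
  refine (mul_le_mul_of_nonneg_left hF (by positivity)).trans ?_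
  rw [intervalIntegral.integral_add hd2 hv2]
  exact element_young (abs_nonneg γ) hc hT (sq_integral_abs_le h hd) (sq_integral_abs_le h hv) hR

theorem betaPW_mem_Icc (βm βp α t : ℝ) :
    betaPW βm βp α t ∈ Icc (min βm βp) (max βm βp) := by
  unfold betaPW
  split_ifs <;> simp

theorem measurable_betaPW (βm βp α : ℝ) : Measurable (betaPW βm βp α) :=
  Measurable.ite measurableSet_Iio measurable_const measurable_const

theorem ContinuousOn.memLp_Ioc {lo hi : ℝ} {u : ℝ → ℝ} (hu : ContinuousOn u (Icc lo hi))
    (q : ENNReal) : MemLp u q (volume.restrict (Ioc lo hi)) := by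
  obtain ⟨B, hB⟩ := isCompact_Icc.exists_bound_of_continuousOn hu
  refine MemLp.of_bound ((hu.mono Ioc_subset_Icc_self).aestronglyMeasurable measurableSet_Ioc) B ?_
  filter_upwards [ae_restrict_mem measurableSet_Ioc] with t ht
  exact hB t (Ioc_subset_Icc_self ht)

theorem element_coercive {p : ℕ} (hp : 1 ≤ p) {lo hi α βm βp γ c : ℝ} {v : ℝ → ℝ}
    {W : Polynomial ℝ} {g A : ℕ → ℝ} (h : lo < hi) (hβm : 0 < βm) (hβp : 0 < βp) (hc : 0 ≤ c)
    (hv : ContinuousOn v (Icc lo hi)) (hWdeg : W.natDegree ≤ p - 1)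
    (hW : ∀ t ∈ Ioo lo hi, t ≠ α → HasDerivAt v (W.eval t / betaPW βm βp α t) t)
    (hg : ∀ j ∈ Finset.Icc 1 p, lo < g j ∧ g j < hi ∧ g j ≠ α)
    (hgg : ∀ j, 1 ≤ j → j < p → g j < g (j + 1))
    (hA : ∀ j ∈ Finset.Icc 1 p, 0 < A j)
    (hq : ∀ F : Polynomial ℝ, F.natDegree ≤ 2 * p - 1 →
      ∑ j ∈ Finset.Icc 1 p, A j * F.eval (g j) = ∫ t in lo..hi, F.eval t / betaPW βm βp α t)
    (hsmall : (hi - lo) * ((|γ| + c) * (max βm βp / min βm βp + 3) / 2)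
      ≤ 1 / 2 * min (min βm βp) c) :
    (∑ n ∈ Finset.Icc 1 p, A n * (betaPW βm βp α (g n) * deriv v (g n)) = v hi - v lo) ∧
    IntervalIntegrable (fun t => γ * deriv v t + c * v t) volume lo hi ∧
    IntervalIntegrable (fun t => deriv v t ^ 2 + v t ^ 2) volume lo hi ∧
    1 / 2 * min (min βm βp) c * (∫ t in lo..hi, (deriv v t ^ 2 + v t ^ 2))
        + γ / 2 * (v hi ^ 2 - v lo ^ 2)
      ≤ (∑ n ∈ Finset.Icc 1 p, A n * (betaPW βm βp α (g n) * deriv v (g n))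
            * (betaPW βm βp α (g n) * deriv v (g n)))
        + (v lo * (∫ t in lo..(g 1), (γ * deriv v t + c * v t))
          + (∑ j ∈ Finset.Icc 1 (p - 1),
              (v lo + ∑ n ∈ Finset.Icc 1 j, A n * (betaPW βm βp α (g n) * deriv v (g n)))
                * ∫ t in (g j)..(g (j + 1)), (γ * deriv v t + c * v t))
          + v hi * ∫ t in (g p)..hi, (γ * deriv v t + c * v t)) := by
  have hm : 0 < min βm βp := lt_min hβm hβp
  have hβ : ∀ t, 0 < betaPW βm βp α t := fun t => hm.trans_le (betaPW_mem_Icc _ _ _ _).1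
  have hmeas := measurable_betaPW βm βp α
  set m := min βm βp
  set M := max βm βp
  set β := betaPW βm βp α with hβ_def
  have hmβ : ∀ t, m ≤ β t := fun t => (betaPW_mem_Icc _ _ _ _).1
  have hβM : ∀ t, β t ≤ M := fun t => (betaPW_mem_Icc _ _ _ _).2
  set d := deriv v
  have hdW : ∀ t ∈ Ioo lo hi, t ≠ α → d t = W.eval t / β t := fun t ht hα => (hW t ht hα).deriv
  have toII {u : ℝ → ℝ} (hu : Integrable u (volume.restrict (Ioc lo hi))) :
      IntervalIntegrable u volume lo hi :=
    (intervalIntegrable_iff_integrableOn_Ioc_of_le h.le).2 hu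
  have hae : ∀ᵐ t ∂(volume.restrict (Ioc lo hi)), d t = W.eval t / β t := by
    filter_upwards [ae_restrict_mem measurableSet_Ioc,
      ae_restrict_of_ae (Measure.ae_ne volume α), ae_restrict_of_ae (Measure.ae_ne volume hi)]
      with t ht h1 h2
    exact hdW t ⟨ht.1, lt_of_le_of_ne ht.2 h2⟩ h1
  have hvL := hv.memLp_Ioc 2
  have hWL : MemLp (fun t => W.eval t) 2 (volume.restrict (Ioc lo hi)) :=
    W.continuous.continuousOn.memLp_Ioc 2
  have hWβ : MemLp (fun t => W.eval t / β t) 2 (volume.restrict (Ioc lo hi)) := by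
    refine (hWL.const_mul m⁻¹).of_le
      (W.continuous.measurable.div hmeas).aestronglyMeasurable (ae_of_all _ fun t => ?_)
    rw [norm_div, norm_mul, norm_inv, Real.norm_of_nonneg hm.le, Real.norm_of_nonneg (hβ t).le,
      div_eq_inv_mul]
    gcongr
    exact hmβ t
  have hdL : MemLp d 2 (volume.restrict (Ioc lo hi)) := (memLp_congr_ae hae).2 hWβ
  have hd1 := toII (hdL.integrable one_le_two)
  have hv1 := toII (hvL.integrable one_le_two)
  have hd2 := toII hdL.integrable_sq
  have hv2 := toII hvL.integrable_sq
  have hvd : IntervalIntegrable (fun t => v t * d t) volume lo hi :=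
    toII (hvL.integrable_mul hdL)
  have hQI : IntervalIntegrable (fun t => W.eval t ^ 2 / β t) volume lo hi :=
    (toII (hWL.integrable_mul hWβ)).congr fun t _ => by simp [sq, mul_div_assoc]
  have hder : ∀ t ∈ Ioo lo hi \ {α}, HasDerivAt v (d t) t := fun t ht => by
    rw [hdW t ht.1 ht.2]; exact hW t ht.1 ht.2
  have hFTC : ∀ s ∈ Icc lo hi, ∫ t in lo..s, d t = v s - v lo := fun s hs =>
    integral_eq_of_hasDerivAt_off_countable_of_le v d hs.1 (countable_singleton α)
      (hv.mono (Icc_subset_Icc_right hs.2))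
      (fun t ht => hder t ⟨⟨ht.1.1, ht.1.2.trans_le hs.2⟩, ht.2⟩)
      (hd1.mono_set (by
        rw [uIcc_of_le hs.1, uIcc_of_le h.le]; exact Icc_subset_Icc_right hs.2))
  have hvv : ∫ t in lo..hi, v t * d t = (v hi ^ 2 - v lo ^ 2) / 2 := by
    have := integral_eq_of_hasDerivAt_off_countable_of_le (fun t => v t ^ 2)
      (fun t => 2 * (v t * d t)) h.le (countable_singleton α) (hv.pow 2)
      (fun t ht => by simpa [mul_assoc] using (hder t ht).fun_pow 2) (hvd.const_mul 2)
    rw [intervalIntegral.integral_const_mul] at this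
    linarith
  have hζ : ∀ n ∈ Finset.Icc 1 p, β (g n) * d (g n) = W.eval (g n) := fun n hn => by
    obtain ⟨h1, h2, h3⟩ := hg n hn
    rw [hdW _ ⟨h1, h2⟩ h3, mul_div_cancel₀ _ (hβ _).ne']
  have q0 : ∑ n ∈ Finset.Icc 1 p, A n ≤ (hi - lo) / m := by
    have h1 := hq 1 (by simp)
    simp only [Polynomial.eval_one, mul_one] at h1
    rw [h1]
    have h2 : ∫ t in lo..hi, 1 / β t ≤ ∫ t in lo..hi, m⁻¹ := by
      refine intervalIntegral.integral_mono_on h.le (toII ?_) (by simp) fun t _ => ?_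
      · refine Integrable.of_bound (measurable_const.div hmeas).aestronglyMeasurable m⁻¹
          (ae_of_all _ fun t => ?_)
        rw [Real.norm_of_nonneg (by have := hβ t; positivity), one_div]
        exact inv_anti₀ hm (hmβ t)
      · rw [one_div]
        exact inv_anti₀ hm (hmβ t)
    simpa [div_eq_mul_inv] using h2
  have q1 : ∑ n ∈ Finset.Icc 1 p, A n * (β (g n) * d (g n)) = v hi - v lo := by
    rw [← hFTC hi ⟨h.le, le_rfl⟩, Finset.sum_congr rfl fun n hn => by rw [hζ n hn],
      hq W (by omega), intervalIntegral.integral_of_le h.le, intervalIntegral.integral_of_le h.le]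
    exact integral_congr_ae (hae.mono fun t ht => ht.symm)
  have q2 : ∑ n ∈ Finset.Icc 1 p, A n * W.eval (g n) ^ 2
      = ∫ t in lo..hi, W.eval t ^ 2 / β t := by
    simpa using hq (W ^ 2) ((Polynomial.natDegree_pow_le).trans (by omega))
  set I1 := ∫ t in lo..hi, d t ^ 2 with hI1
  set I0 := ∫ t in lo..hi, v t ^ 2 with hI0
  have hI1n : 0 ≤ I1 := intervalIntegral.integral_nonneg h.le fun _ _ => sq_nonneg _
  have hI0n : 0 ≤ I0 := intervalIntegral.integral_nonneg h.le fun _ _ => sq_nonneg _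
  have hlow : m * I1 ≤ ∫ t in lo..hi, W.eval t ^ 2 / β t := by
    rw [hI1, ← intervalIntegral.integral_const_mul]
    refine intervalIntegral.integral_mono_ae_restrict h.le (hd2.const_mul m) hQI ?_
    rw [← restrict_Ioc_eq_restrict_Icc]
    filter_upwards [hae] with t ht
    have e : W.eval t ^ 2 / β t = β t * d t ^ 2 := by
      have := (hβ t).ne'
      rw [ht]; field_simp
    rw [e]
    exact mul_le_mul_of_nonneg_right (hmβ t) (sq_nonneg _)
  have hupp : ∫ t in lo..hi, W.eval t ^ 2 / β t ≤ M * I1 := by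
    rw [hI1, ← intervalIntegral.integral_const_mul]
    refine intervalIntegral.integral_mono_ae_restrict h.le hQI (hd2.const_mul M) ?_
    rw [← restrict_Ioc_eq_restrict_Icc]
    filter_upwards [hae] with t ht
    have e : W.eval t ^ 2 / β t = β t * d t ^ 2 := by
      have := (hβ t).ne'
      rw [ht]; field_simp
    rw [e]
    exact mul_le_mul_of_nonneg_right (hβM t) (sq_nonneg _)
  set T := ∑ n ∈ Finset.Icc 1 p, A n * |W.eval (g n)| with hT_def
  have hT0 : 0 ≤ T := Finset.sum_nonneg fun n hn => mul_nonneg (hA n hn).le (abs_nonneg _)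
  have hM : 0 ≤ M := (hm.trans_le min_le_max).le
  have hT : T ^ 2 ≤ M / m * ((hi - lo) * I1) := by
    calc T ^ 2 ≤ (∑ n ∈ Finset.Icc 1 p, A n) * ∑ n ∈ Finset.Icc 1 p, A n * W.eval (g n) ^ 2 :=
          Finset.sum_sq_le_sum_mul_sum_of_sq_le_mul _ (fun n hn => (hA n hn).le)
            (fun n hn => mul_nonneg (hA n hn).le (sq_nonneg _))
            (fun n _ => by rw [mul_pow, sq_abs]; exact le_of_eq (by ring))
      _ ≤ ((hi - lo) / m) * (M * I1) := by
          rw [q2]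
          exact mul_le_mul q0 hupp ((mul_nonneg hm.le hI1n).trans hlow)
            (div_nonneg (sub_nonneg.2 h.le) hm.le)
      _ = M / m * ((hi - lo) * I1) := by ring
  have hf : IntervalIntegrable (fun t => γ * d t + c * v t) volume lo hi :=
    (hd1.const_mul γ).add (hv1.const_mul c)
  refine ⟨q1, hf, hd2.add hv2, ?_⟩
  obtain ⟨q, rfl⟩ : ∃ q, p = q + 1 := ⟨p - 1, by omega⟩
  set S : ℕ → ℝ := fun j => v lo + ∑ n ∈ Finset.Icc 1 j, A n * (β (g n) * d (g n)) with hS_def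
  set y : ℕ → ℝ := fun j => if j = 0 then lo else if j = q + 2 then hi else g j with hy_def
  have hyg : ∀ j < q + 1, y (j + 1) = g (j + 1) := fun j hj => by
    simp only [hy_def]; rw [if_neg (by omega), if_neg (by omega)]
  have hy0 : y 0 = lo := by simp [hy_def]
  have hyl : y (q + 2) = hi := by simp [hy_def]
  have key := abs_element_sum_sub_le (γ := γ) (n := q + 2) (y := y) (S := S) h.le hvL hdL hFTC hc
    (fun j hj => by
      rcases Nat.eq_zero_or_pos j with rfl | hj0
      · rw [hy0, hyg 0 (by omega)]; exact (hg 1 (by simp)).1.le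
      · obtain ⟨i, rfl⟩ : ∃ i, j = i + 1 := ⟨j - 1, by omega⟩
        rw [hyg i (by omega)]
        rcases (Nat.lt_succ_iff.1 hj).eq_or_lt with hi' | hi'
        · rw [hi', show q + 1 + 1 = q + 2 from rfl, hyl]
          exact (hg (q + 1) (by simp)).2.1.le
        · rw [hyg (i + 1) (by omega)]
          exact (hgg (i + 1) (by omega) (by omega)).le)
    hy0 hyl hT0
    (fun j hj => by
      have hsub : Finset.Icc 1 j ⊆ Finset.Icc 1 (q + 1) := Finset.Icc_subset_Icc_right (by omega)
      rw [hS_def, add_sub_cancel_left]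
      refine (Finset.abs_sum_le_sum_abs _ _).trans ?_
      rw [hT_def]
      refine (Finset.sum_le_sum fun n hn => ?_).trans
        (Finset.sum_le_sum_of_subset_of_nonneg hsub fun n hn _ =>
          mul_nonneg (hA n hn).le (abs_nonneg _))
      rw [hζ n (hsub hn), abs_mul, abs_of_pos (hA n (hsub hn))])
    (div_nonneg hM hm.le) hT
  have hvf : ∫ t in lo..hi, v t * (γ * d t + c * v t)
      = γ / 2 * (v hi ^ 2 - v lo ^ 2) + c * I0 := by
    rw [show (fun t => v t * (γ * d t + c * v t)) = fun t => γ * (v t * d t) + c * v t ^ 2 by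
      funext t; ring, intervalIntegral.integral_add (hvd.const_mul γ) (hv2.const_mul c),
      intervalIntegral.integral_const_mul, intervalIntegral.integral_const_mul, hvv]
    ring
  rw [hvf, intervalIntegral.integral_add hd2 hv2, ← hI1, ← hI0, Finset.sum_range_succ,
    Finset.sum_range_succ', hy0, hyl, hyg 0 (by omega), hyg q (by omega),
    show S (q + 1) = v hi by simp only [hS_def]; rw [q1]; ring,
    show S 0 = v lo by simp [hS_def]] at key
  have hmid : ∑ j ∈ Finset.range q,
        S (j + 1) * ∫ t in (y (j + 1))..(y (j + 1 + 1)), (γ * d t + c * v t)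
      = ∑ j ∈ Finset.Icc 1 q, S j * ∫ t in (g j)..(g (j + 1)), (γ * d t + c * v t) := by
    rw [Finset.sum_congr rfl fun j hj => by
      rw [hyg j (by simp at hj; omega), hyg (j + 1) (by simp at hj; omega)], Finset.range_eq_Ico]
    exact Finset.sum_Ico_add'
      (fun j => S j * ∫ t in (g j)..(g (j + 1)), (γ * d t + c * v t)) 0 q 1
  rw [hmid] at key
  have hquad : ∑ n ∈ Finset.Icc 1 (q + 1), A n * (β (g n) * d (g n)) * (β (g n) * d (g n))
      = ∫ t in lo..hi, W.eval t ^ 2 / β t := by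
    rw [← q2]
    exact Finset.sum_congr rfl fun n hn => by rw [hζ n hn]; ring
  rw [hquad, intervalIntegral.integral_add hd2 hv2, ← hI1, ← hI0]
  have hsm := mul_le_mul_of_nonneg_right hsmall (add_nonneg hI1n hI0n)
  have hk := (abs_le.1 key).1
  have e1 := mul_le_mul_of_nonneg_right (min_le_left m c) hI1n
  have e0 := mul_le_mul_of_nonneg_right (min_le_right m c) hI0n
  simp only [add_tsub_cancel_right]
  linarith

theorem hasDerivAt_of_eqOn_polynomial {r s t β : ℝ} {v : ℝ → ℝ} {q : Polynomial ℝ}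
    (hβ : β ≠ 0) (hq : ∀ y ∈ Icc r s, v y = q.eval y) (ht : t ∈ Ioo r s) :
    HasDerivAt v ((Polynomial.C β * q.derivative).eval t / β) t := by
  rw [Polynomial.eval_C_mul, mul_div_cancel_left₀ _ hβ]
  refine (q.hasDerivAt t).congr_of_eventuallyEq ?_
  filter_upwards [Icc_mem_nhds ht.1 ht.2] with y hy using hq y hy

theorem MemUT.exists_flux {p N k : ℕ} {a b α βm βp : ℝ} {x : ℕ → ℝ} {v : ℝ → ℝ}
    (hv : MemUT p N k a b α βm βp x v) (hβm : 0 < βm) (hβp : 0 < βp)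
    (hx : ∀ i j, i ≤ j → j ≤ N → x i ≤ x j) (hk : k ≤ N)
    (hk1 : x (k - 1) < α) (hk2 : α < x k) {i : ℕ} (hi : 1 ≤ i) (hiN : i ≤ N) :
    ∃ W : Polynomial ℝ, W.natDegree ≤ p - 1 ∧ ∀ t ∈ Ioo (x (i - 1)) (x i), t ≠ α →
      HasDerivAt v (W.eval t / betaPW βm βp α t) t := by
  obtain ⟨-, -, -, hpoly, qm, qp, hqm, hqp, hvm, hvp, hjump⟩ := hv
  have hdeg (r : ℝ) {q : Polynomial ℝ} (hq : q.natDegree ≤ p) :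
      (Polynomial.C r * q.derivative).natDegree ≤ p - 1 :=
    (Polynomial.natDegree_C_mul_le _ _).trans
      (q.natDegree_derivative_le.trans (Nat.sub_le_sub_right hq 1))
  rcases lt_trichotomy i k with hik | rfl | hik
  · obtain ⟨q, hq, hvq⟩ := hpoly i hi hiN hik.ne
    refine ⟨Polynomial.C βm * q.derivative, hdeg _ hq, fun t ht _ => ?_⟩
    have : t < α := ht.2.trans_le ((hx i (k - 1) (by omega) (by omega)).trans hk1.le)
    rw [betaPW, if_pos this]
    exact hasDerivAt_of_eqOn_polynomial hβm.ne' hvq ht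
  · refine ⟨Polynomial.C βm * qm.derivative, hdeg _ hqm, fun t ht hα => ?_⟩
    rcases hα.lt_or_gt with hlt | hgt
    · rw [betaPW, if_pos hlt]
      exact hasDerivAt_of_eqOn_polynomial hβm.ne' hvm ⟨ht.1, hlt⟩
    · rw [betaPW, if_neg hgt.not_gt, C_mul_derivative_eq hqm hqp hjump]
      exact hasDerivAt_of_eqOn_polynomial hβp.ne' hvp ⟨hgt, ht.2⟩
  · obtain ⟨q, hq, hvq⟩ := hpoly i hi hiN hik.ne'
    refine ⟨Polynomial.C βp * q.derivative, hdeg _ hq, fun t ht _ => ?_⟩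
    have : α < t := (hk2.trans_le (hx k (i - 1) (by omega) (by omega))).trans ht.1
    rw [betaPW, if_neg this.not_gt]
    exact hasDerivAt_of_eqOn_polynomial hβp.ne' hvq ht

theorem sum_Icc_sub_pred (V : ℕ → ℝ) (n : ℕ) :
    ∑ i ∈ Finset.Icc 1 n, (V i - V (i - 1)) = V n - V 0 := by
  induction n with
  | zero => simp
  | succ n ih => rw [Finset.sum_Icc_succ_top (by omega), ih]; simp

theorem sum_Icc_regroup (V L M E : ℕ → ℝ) (hV : V 0 = 0) (n : ℕ) :
    ∑ i ∈ Finset.Icc 1 (n + 1), (V (i - 1) * L i + M i + V i * E i)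
      = ∑ i ∈ Finset.Icc 1 (n + 1), M i + ∑ i ∈ Finset.Icc 1 n, V i * (E i + L (i + 1))
        + V (n + 1) * E (n + 1) := by
  induction n with
  | zero => simp [hV]
  | succ n ih =>
    rw [Finset.sum_Icc_succ_top (by omega), ih,
      Finset.sum_Icc_succ_top (f := M) (by omega : 1 ≤ n + 1 + 1),
      Finset.sum_Icc_succ_top (f := fun i => V i * (E i + L (i + 1))) (by omega : 1 ≤ n + 1)]
    simp only [add_tsub_cancel_right]
    ring

theorem sum_Icc_ite_pred {p : ℕ} (hp : 1 ≤ p) (Q : ℕ → ℕ → ℝ) (n : ℕ) :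
    ∑ i ∈ Finset.Icc 1 (n + 1), ∑ j ∈ Finset.Icc 1 (if i < n + 1 then p else p - 1), Q i j
      = ∑ i ∈ Finset.Icc 1 (n + 1), ∑ j ∈ Finset.Icc 1 (p - 1), Q i j
        + ∑ i ∈ Finset.Icc 1 n, Q i p := by
  obtain ⟨q, rfl⟩ : ∃ q, p = q + 1 := ⟨p - 1, by omega⟩
  rw [Finset.sum_Icc_succ_top (by omega), Finset.sum_Icc_succ_top (by omega : 1 ≤ n + 1)]
  have : ∀ i ∈ Finset.Icc 1 n, ∑ j ∈ Finset.Icc 1 (if i < n + 1 then q + 1 else q + 1 - 1), Q i j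
      = ∑ j ∈ Finset.Icc 1 (q + 1 - 1), Q i j + Q i (q + 1) := fun i hi => by
    rw [Finset.mem_Icc] at hi
    rw [if_pos (by omega), Finset.sum_Icc_succ_top (by omega)]
    simp
  rw [Finset.sum_congr rfl this, Finset.sum_add_distrib]
  simp only [lt_self_iff_false, if_false]
  ring

/-- for `c > 0` there is `h₀ > 0`, depending only on `p`, `β⁻`, `β⁺`, `γ` and
`c`, such that whenever all mesh sizes are ≤ h₀, every `v ∈ U_T` satisfies the coercivity
bound `a(v, Π_h v) ≥ ½ min{min(β⁻,β⁺), c} ‖v‖₁²`. -/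
theorem stmt_10 (p : ℕ) (hp : 1 ≤ p) (βm βp γ c : ℝ)
    (hβm : 0 < βm) (hβp : 0 < βp) (hc : 0 < c) :
    ∃ h₀ : ℝ, 0 < h₀ ∧
    (∀ (N k : ℕ) (a b α : ℝ) (x : ℕ → ℝ) (g A : ℕ → ℕ → ℝ),
    1 ≤ N →
    1 ≤ k →
    k ≤ N →
    a < b →
    x 0 = a →
    x N = b →
    (∀ i, i < N → x i < x (i + 1)) →
    x (k - 1) < α →
    α < x k →
    (∀ i ∈ Finset.Icc 1 N, ∀ j ∈ Finset.Icc 1 p,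
      x (i - 1) < g i j ∧ g i j < x i ∧ g i j ≠ α) →
    (∀ i ∈ Finset.Icc 1 N, ∀ j, 1 ≤ j → j < p → g i j < g i (j + 1)) →
    (∀ i, 1 ≤ i → i < N → g i (p + 1) = g (i + 1) 1) →
    (∀ i ∈ Finset.Icc 1 N, ∀ j ∈ Finset.Icc 1 p, 0 < A i j) →
    (∀ i ∈ Finset.Icc 1 N, ∀ F : Polynomial ℝ, F.natDegree ≤ 2 * p - 1 →
      ∑ j ∈ Finset.Icc 1 p, A i j * F.eval (g i j)
        = ∫ t in (x (i - 1))..(x i), F.eval t / betaPW βm βp α t) →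
    (∀ i ∈ Finset.Icc 1 N, x i - x (i - 1) ≤ h₀) →
    ∀ v : ℝ → ℝ, MemUT p N k a b α βm βp x v →
    (1 / 2) * min (min βm βp) c * (∫ t in a..b, ((deriv v t) ^ 2 + (v t) ^ 2))
      ≤ aform N p γ c βm βp α g v (pih N p βm βp α g A v)) := by
  have hm : 0 < min βm βp := lt_min hβm hβp
  have hM : 0 < max βm βp := hm.trans_le min_le_max
  refine ⟨min (min βm βp) c / ((|γ| + c) * (max βm βp / min βm βp + 3)), by positivity, ?_⟩
  intro N k a b α x g A hN hk hkN hab hx0 hxN hx hk1 hk2 hg hgg hgn hA hq hh v hv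
  have hmono : ∀ i j, i ≤ j → j ≤ N → x i ≤ x j := fun i j hij => by
    induction j, hij using Nat.le_induction with
    | base => exact fun _ => le_rfl
    | succ j _ ih => exact fun hj => (ih (by omega)).trans (hx j (by omega)).le
  have hlt : ∀ i ∈ Finset.Icc 1 N, x (i - 1) < x i := fun i hi => by
    rw [Finset.mem_Icc] at hi
    simpa [Nat.sub_add_cancel hi.1] using hx (i - 1) (by omega)
  set β := betaPW βm βp α with hβ_def
  set f : ℝ → ℝ := fun t => γ * deriv v t + c * v t
  set z : ℕ → ℕ → ℝ := fun i n => A i n * (β (g i n) * deriv v (g i n))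
  choose! W hW using fun i (hi : i ∈ Finset.Icc 1 N) =>
    hv.exists_flux hβm hβp hmono hkN hk1 hk2 (Finset.mem_Icc.1 hi).1 (Finset.mem_Icc.1 hi).2
  have hsub : ∀ i ∈ Finset.Icc 1 N, Icc (x (i - 1)) (x i) ⊆ Icc a b := fun i hi => by
    rw [Finset.mem_Icc] at hi
    exact Icc_subset_Icc (hx0 ▸ hmono 0 _ (Nat.zero_le _) (by omega))
      (hxN ▸ hmono _ _ hi.2 le_rfl)
  have hsmall : ∀ i ∈ Finset.Icc 1 N,
      (x i - x (i - 1)) * ((|γ| + c) * (max βm βp / min βm βp + 3) / 2)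
        ≤ 1 / 2 * min (min βm βp) c := fun i hi => by
    have h1 := hh i hi
    rw [le_div_iff₀ (by positivity)] at h1
    linarith
  have elem := fun i (hi : i ∈ Finset.Icc 1 N) =>
    element_coercive hp (γ := γ) (c := c) (g := g i) (A := A i) (hlt i hi) hβm hβp hc.le
      (hv.1.mono (hsub i hi)) (hW i hi).1 (hW i hi).2 (hg i hi) (hgg i hi) (hA i hi) (hq i hi)
      (hsmall i hi)
  have hva : v (x 0) = 0 := hx0 ▸ hv.2.1
  have hvb : v (x N) = 0 := hxN ▸ hv.2.2.1
  have hsum : ∀ n ≤ N, ∑ i ∈ Finset.Icc 1 n, ∑ j ∈ Finset.Icc 1 p, z i j = v (x n) := fun n hn => by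
    rw [Finset.sum_congr rfl fun i hi => (elem i (Finset.Icc_subset_Icc_right hn hi)).1,
      sum_Icc_sub_pred (fun i => v (x i)), hva, sub_zero]
  set w := pih N p βm βp α g A v with hw_def
  have hw : ∀ i ∈ Finset.Icc 1 N, ∀ j ∈ Finset.Icc 1 p,
      w i j = v (x (i - 1)) + ∑ n ∈ Finset.Icc 1 j, z i n := fun i hi j hj => by
    rw [hw_def, pih]
    rw [Finset.mem_Icc] at hi
    split_ifs with hij
    · rw [hij.1, hij.2, (elem N (by simp [hN])).1, hvb]
      ring
    · exact congrArg (· + _) (hsum (i - 1) (by omega))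
  have hwp : ∀ i ∈ Finset.Icc 1 N, w i p = v (x i) := fun i hi => by
    rw [hw i hi p (by simp [hp]), (elem i hi).1]
    ring
  have hjmp : ∀ i ∈ Finset.Icc 1 N, ∀ j ∈ Finset.Icc 1 p, jmp p w i j = z i j := fun i hi j hj => by
    have hi' := Finset.mem_Icc.1 hi
    have hj' := Finset.mem_Icc.1 hj
    rw [jmp, vprev, hw i hi j hj]
    split_ifs with h1 h2
    · rw [h1, h2, Nat.sub_self, hva]
      simp
    · rw [h1, hwp (i - 1) (by simp; omega)]
      simp
    · rw [hw i hi (j - 1) (by simp; omega)]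
      obtain ⟨l, rfl⟩ : ∃ l, j = l + 1 := ⟨j - 1, by omega⟩
      rw [Finset.sum_Icc_succ_top (by omega)]
      simp
  obtain ⟨n, rfl⟩ : ∃ n, N = n + 1 := ⟨N - 1, by omega⟩
  have hform : aform (n + 1) p γ c βm βp α g v w
      = ∑ i ∈ Finset.Icc 1 (n + 1), ((∑ j ∈ Finset.Icc 1 p,
          A i j * (β (g i j) * deriv v (g i j)) * (β (g i j) * deriv v (g i j)))
        + (v (x (i - 1)) * (∫ t in (x (i - 1))..(g i 1), f t)
          + (∑ j ∈ Finset.Icc 1 (p - 1),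
              (v (x (i - 1)) + ∑ m ∈ Finset.Icc 1 j, z i m) * ∫ t in (g i j)..(g i (j + 1)), f t)
          + v (x i) * ∫ t in (g i p)..(x i), f t)) := by
    rw [Finset.sum_add_distrib, aform, sum_Icc_ite_pred hp,
      sum_Icc_regroup (fun i => v (x i)) (fun i => ∫ t in (x (i - 1))..(g i 1), f t)
        (fun i => ∑ j ∈ Finset.Icc 1 (p - 1),
          (v (x (i - 1)) + ∑ m ∈ Finset.Icc 1 j, z i m) * ∫ t in (g i j)..(g i (j + 1)), f t)
        (fun i => ∫ t in (g i p)..(x i), f t) hva, hvb, zero_mul, add_zero]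
    congr 1
    · exact Finset.sum_congr rfl fun i hi => Finset.sum_congr rfl fun j hj => by
        rw [hjmp i hi j hj]
    · congr 1
      · exact Finset.sum_congr rfl fun i hi => Finset.sum_congr rfl fun j hj => by
          rw [hw i hi j (Finset.Icc_subset_Icc_right (Nat.sub_le _ _) hj)]
      · refine Finset.sum_congr rfl fun i hi => ?_
        have hi' := Finset.mem_Icc.1 hi
        have hiN : i ∈ Finset.Icc 1 (n + 1) := by simp; omega
        have hiN' : i + 1 ∈ Finset.Icc 1 (n + 1) := by simp; omega
        rw [hwp i hiN, hgn i hi'.1 (by omega), add_tsub_cancel_right,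
          intervalIntegral.integral_add_adjacent_intervals]
        · refine (elem i hiN).2.1.mono_set (uIcc_subset_uIcc ?_ right_mem_uIcc)
          obtain ⟨h1, h2, -⟩ := hg i hiN p (by simp [hp])
          exact Icc_subset_uIcc ⟨h1.le, h2.le⟩
        · refine (elem (i + 1) hiN').2.1.mono_set (uIcc_subset_uIcc left_mem_uIcc ?_)
          obtain ⟨h1, h2, -⟩ := hg (i + 1) hiN' 1 (by simp [hp])
          exact Icc_subset_uIcc ⟨h1.le, h2.le⟩
  rw [hform]
  refine le_trans (le_of_eq ?_) (Finset.sum_le_sum fun i hi => (elem i hi).2.2.2)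
  rw [Finset.sum_add_distrib, ← Finset.mul_sum, ← Finset.mul_sum,
    sum_Icc_integral_eq fun i hi => (elem i hi).2.2.1, sum_Icc_sub_pred (fun i => v (x i) ^ 2),
    hva, hvb, hx0, hxN]
  ring
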